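/- arXiv:1501.00190 — 2 statements merged into one kernel-verified Lean document; each statement's English description precedes it below -/
import Mathlib

section
/- Let Q be a Markov kernel on ℝ^d satisfying the drift condition (A4) with constants c > 0, ρ ∈ (0,1), R > 0, K > 0, and let Ψ : ℝ^d × ℝ^ℓ → (0,∞) be measurable with sup_{x,y,x'} Ψ(x,y)/Ψ(x',y) ≤ 1+δ for some δ > 0. Then for every y ∈ ℝ^ℓ, every probability measure μ on ℝ^d, and every x with |x| ≤ R, the conditional kernel Q̄^{y,μ} satisfies ∫ e^{c|x'|} Q̄^{y,μ}(x,dx') ≤ (1+δ) K. -/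
open MeasureTheory ProbabilityTheory ENNReal

noncomputable section

/-- The Euclidean state space `ℝ^d`. -/
abbrev St (d : ℕ) : Type := EuclideanSpace ℝ (Fin d)

/-- Exponential weight `e^{c‖x‖}` viewed in `ℝ≥0∞`. -/
def expW {d : ℕ} (c : ℝ) (x : St d) : ℝ≥0∞ := ENNReal.ofReal (Real.exp (c * ‖x‖))

/-- Drift condition (A4) for a kernel `Q`. -/
def DriftCond {d : ℕ} (Q : Kernel (St d) (St d)) (c ρ R K : ℝ) : Prop :=
  (∀ x : St d, R ≤ ‖x‖ →
      ∫⁻ x', expW c x' ∂(Q x) ≤ ENNReal.ofReal (ρ * Real.exp (c * ‖x‖))) ∧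
  (∀ x : St d, ‖x‖ ≤ R → ∫⁻ x', expW c x' ∂(Q x) ≤ ENNReal.ofReal K)

/-- One step of the non-normalized filter: prediction by `Q`, then weighting by `Ψ(·, y)`. -/
def step {d l : ℕ} (Q : Kernel (St d) (St d)) (Ψ : St d → St l → ℝ) (y : St l)
    (μ : Measure (St d)) : Measure (St d) :=
  (μ.bind fun x => Q x).withDensity fun x' => ENNReal.ofReal (Ψ x' y)

/-- Non-normalized filtering operator along a list of observations
(the observations are applied in chronological order). -/
def nnFilter {d l : ℕ} (Q : Kernel (St d) (St d)) (Ψ : St d → St l → ℝ)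
    (ys : List (St l)) (μ : Measure (St d)) : Measure (St d) :=
  ys.foldl (fun m y => step Q Ψ y m) μ

/-- Normalization of a measure. -/
def normalizeM {α : Type*} [MeasurableSpace α] (μ : Measure α) : Measure α :=
  (μ Set.univ)⁻¹ • μ

/-- Normalized filtering operator `μ S̄_{k:n}`. -/
def nFilter {d l : ℕ} (Q : Kernel (St d) (St d)) (Ψ : St d → St l → ℝ)
    (ys : List (St l)) (μ : Measure (St d)) : Measure (St d) :=
  normalizeM (nnFilter Q Ψ ys μ)

/-- One-step normalized update `μ ↦ μ Q̄^y`. -/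
def stepBar {d l : ℕ} (Q : Kernel (St d) (St d)) (Ψ : St d → St l → ℝ) (y : St l)
    (μ : Measure (St d)) : Measure (St d) :=
  normalizeM (step Q Ψ y μ)

/-- The conditional kernel `Q̄^{y,μ}(x, dx') = Q(x,dx') Ψ(x',y) / ∬ Q(x̃,dx₁) Ψ(x₁,y) μ(dx̃)`. -/
def condBar {d l : ℕ} (Q : Kernel (St d) (St d)) (Ψ : St d → St l → ℝ) (y : St l)
    (μ : Measure (St d)) (x : St d) : Measure (St d) :=
  (step Q Ψ y μ Set.univ)⁻¹ • ((Q x).withDensity fun x' => ENNReal.ofReal (Ψ x' y))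

/-- Total variation distance between two measures. -/
def tvDist {α : Type*} [MeasurableSpace α] (μ ν : Measure α) : ℝ≥0∞ :=
  ⨆ A : Set α, ((μ A - ν A) + (ν A - μ A))

/-- Birkhoff (Hilbert, projective) distance between two measures. -/
def birkhoffDist {α : Type*} [MeasurableSpace α] (μ ν : Measure α) : ℝ≥0∞ :=
  ⨅ (s : ℝ) (t : ℝ) (_ : 0 < t)
    (_ : ∀ A : Set α, μ A ≤ ENNReal.ofReal s * ν A)
    (_ : ∀ A : Set α, ENNReal.ofReal t * ν A ≤ μ A),
    ENNReal.ofReal (Real.log (s / t))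

/-- Expectation of a functional of the observations `Y_{1:n}` under the exact model
started from `μ₀`: the joint density of `Y_{1:n}` at `y` is the total mass of the
non-normalized filter. -/
def obsExp {d l : ℕ} (Q : Kernel (St d) (St d)) (Ψ : St d → St l → ℝ)
    (μ₀ : Measure (St d)) (n : ℕ) (f : (Fin n → St l) → ℝ≥0∞) : ℝ≥0∞ :=
  ∫⁻ y : Fin n → St l, f y * nnFilter Q Ψ (List.ofFn y) μ₀ Set.univ

/-- Law at time `n` of the homogeneous Markov chain with kernel `Q` started at `x`. -/
def chainLaw {d : ℕ} (Q : Kernel (St d) (St d)) (x : St d) : ℕ → Measure (St d)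
  | 0 => Measure.dirac x
  | n + 1 => (chainLaw Q x n).bind fun z => Q z

/-- `survLaw Q R x n` is the law at time `n` of the chain started at `x` and killed
when entering the closed ball of radius `R`; thus `survLaw Q R x n {z | R < ‖z‖}`
is the probability that the hitting time `τ̂_R` exceeds `n`. -/
def survLaw {d : ℕ} (Q : Kernel (St d) (St d)) (R : ℝ) (x : St d) : ℕ → Measure (St d)
  | 0 => Measure.dirac x
  | n + 1 => ((survLaw Q R x n).restrict {z | R < ‖z‖}).bind fun z => Q z

/-- `E_x exp(λ τ̂_R)`, via the identity `e^{λτ} = 1 + (e^λ - 1) ∑_{n<τ} e^{λn}`. -/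
def expHit {d : ℕ} (Q : Kernel (St d) (St d)) (R lam : ℝ) (x : St d) : ℝ≥0∞ :=
  1 + ENNReal.ofReal (Real.exp lam - 1) *
      ∑' n : ℕ, ENNReal.ofReal (Real.exp (lam * n)) * survLaw Q R x n {z | R < ‖z‖}

/-- Law at time `n` of the time-inhomogeneous Markov chain whose `i`-th step uses
the kernel `P i` (steps `1, …, n`), started at `x`. -/
def chainLawSeq {α : Type*} [MeasurableSpace α] (P : ℕ → Kernel α α) (x : α) :
    ℕ → Measure α
  | 0 => Measure.dirac x
  | n + 1 => (chainLawSeq P x n).bind fun z => P (n + 1) z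

/-- Composition of a list of (sub-)kernels given as measure-valued maps, applied at `x`. -/
def condComp {α : Type*} [MeasurableSpace α] (ks : List (α → Measure α)) (x : α) :
    Measure α :=
  ks.foldl (fun m k => m.bind k) (Measure.dirac x)

/-- The list of observations `y_{k+1}, …, y_n` (in chronological order). -/
def obsList {l : ℕ} (y : ℕ → St l) (k n : ℕ) : List (St l) :=
  (List.range (n - k)).map fun i => y (k + 1 + i)

/-- The wrong filter `μ'_k`, defined recursively by one-step normalized updates with the
wrong kernel `P` and wrong observation density `Ξ`. -/
def wrongFilter {d l : ℕ} (P : Kernel (St d) (St d)) (Ξ : St d → St l → ℝ)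
    (y : ℕ → St l) (μ₀ : Measure (St d)) : ℕ → Measure (St d)
  | 0 => μ₀
  | k + 1 => stepBar P Ξ (y (k + 1)) (wrongFilter P Ξ y μ₀ k)

end

/-- A pointwise bound `Ψ x₀ y ≤ C Ψ x y`, uniform in `x`, passes to the normalizing constant. -/
theorem ofReal_le_mul_step_univ {d l : ℕ} (Q : Kernel (St d) (St d)) [IsMarkovKernel Q]
    {Ψ : St d → St l → ℝ} {C : ℝ} {x₀ : St d} {y : St l} (hC : 0 ≤ C)
    (hΨ : ∀ x, Ψ x₀ y ≤ C * Ψ x y) (μ : Measure (St d)) [IsProbabilityMeasure μ] :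
    ENNReal.ofReal (Ψ x₀ y) ≤ ENNReal.ofReal C * step Q Ψ y μ Set.univ := by
  have : IsProbabilityMeasure (μ.bind fun x => Q x) :=
    isProbabilityMeasure_bind Q.aemeasurable (.of_forall fun x => inferInstance)
  rw [step, withDensity_apply _ .univ, Measure.restrict_univ,
    ← lintegral_const_mul' _ _ ofReal_ne_top]
  calc ENNReal.ofReal (Ψ x₀ y)
      = ∫⁻ _, ENNReal.ofReal (Ψ x₀ y) ∂(μ.bind fun x => Q x) := by simp
    _ ≤ _ := lintegral_mono fun x => by
        rw [← ofReal_mul hC]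
        exact ofReal_le_ofReal (hΨ x)

/-- If `Ψ(·, y)` varies by at most a factor `C`, then the conditional kernel is at most
`C` times the original kernel. -/
theorem condBar_le_smul {d l : ℕ} (Q : Kernel (St d) (St d)) [IsMarkovKernel Q]
    {Ψ : St d → St l → ℝ} {C : ℝ} {y : St l} (hC : 0 ≤ C)
    (hΨ : ∀ x x', Ψ x y ≤ C * Ψ x' y) (μ : Measure (St d)) [IsProbabilityMeasure μ]
    (h0 : step Q Ψ y μ Set.univ ≠ 0) (hT : step Q Ψ y μ Set.univ ≠ ⊤) (x : St d) :
    condBar Q Ψ y μ x ≤ ENNReal.ofReal C • Q x := by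
  have h : (Q x).withDensity (fun x' => ENNReal.ofReal (Ψ x' y)) ≤
      (ENNReal.ofReal C * step Q Ψ y μ Set.univ) • Q x := by
    rw [← withDensity_const]
    exact withDensity_mono (.of_forall fun x' => ofReal_le_mul_step_univ Q hC (hΨ x') μ)
  calc condBar Q Ψ y μ x
      ≤ (step Q Ψ y μ Set.univ)⁻¹ • (ENNReal.ofReal C * step Q Ψ y μ Set.univ) • Q x := by
        unfold condBar
        gcongr
    _ = ENNReal.ofReal C • Q x := by
        rw [smul_smul, mul_left_comm, ENNReal.inv_mul_cancel h0 hT, mul_one]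

theorem condKernel_drift_small {d l : ℕ} (Q : Kernel (St d) (St d)) [IsMarkovKernel Q]
    (c ρ R K : ℝ) (hc : 0 < c) (hρ : ρ ∈ Set.Ioo (0 : ℝ) 1) (hR : 0 < R) (hK : 0 < K)
    (hA4 : DriftCond Q c ρ R K)
    (Ψ : St d → St l → ℝ) (hΨm : Measurable (Function.uncurry Ψ))
    (hΨpos : ∀ (x : St d) (y : St l), 0 < Ψ x y)
    (δ : ℝ) (hδ : 0 < δ)
    (hA5 : ∀ (x x' : St d) (y : St l), Ψ x y ≤ (1 + δ) * Ψ x' y)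
    (y : St l) (μ : Measure (St d)) [IsProbabilityMeasure μ]
    (hden0 : 0 < step Q Ψ y μ Set.univ) (hdenT : step Q Ψ y μ Set.univ ≠ ⊤)
    (x : St d) (hx : ‖x‖ ≤ R) :
    ∫⁻ x', expW c x' ∂(condBar Q Ψ y μ x) ≤ ENNReal.ofReal ((1 + δ) * K) := by
  have hC : 0 ≤ 1 + δ := by linarith
  calc ∫⁻ x', expW c x' ∂(condBar Q Ψ y μ x)
      ≤ ∫⁻ x', expW c x' ∂(ENNReal.ofReal (1 + δ) • Q x) :=
        lintegral_mono' (condBar_le_smul Q hC (fun x x' => hA5 x x' y) μ hden0.ne' hdenT x) le_rfl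
    _ = ENNReal.ofReal (1 + δ) * ∫⁻ x', expW c x' ∂(Q x) := by
        rw [lintegral_smul_measure, smul_eq_mul]
    _ ≤ ENNReal.ofReal (1 + δ) * ENNReal.ofReal K := by
        gcongr
        exact hA4.2 x hx
    _ = ENNReal.ofReal ((1 + δ) * K) := (ofReal_mul hC).symm
end

section
/- Let Q, P be Markov kernels on ℝ^d and Ψ, Ξ : ℝ^d × ℝ^ℓ → (0,∞) measurable, and fix observations y_1,…,y_n ∈ ℝ^ℓ. Define the exact filter by μ_n := μ_0 S̄_{0:n} (built from Q, Ψ) and the wrong filter recursively by μ'_0 := μ_0 and μ'_k := μ'_{k−1} P̄^{y_k} (built from P, Ξ), all normalizations being positive and finite. Then μ'_n − μ_n = Σ_{k=1}^n [ (μ'_{k−1} P̄^{y_k}) S̄_{k:n} − (μ'_{k−1} Q̄^{y_k}) S̄_{k:n} ], and consequently ‖μ'_n − μ_n‖_TV ≤ Σ_{k=1}^n ‖(μ'_{k−1} P̄^{y_k}) S̄_{k:n} − (μ'_{k−1} Q̄^{y_k}) S̄_{k:n}‖_TV. -/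
open MeasureTheory ProbabilityTheory ENNReal

/-- Normalization forgets a positive finite scalar factor. -/
theorem normalizeM_smul {α : Type*} [MeasurableSpace α] (c : ℝ≥0∞) (hc0 : c ≠ 0) (hc : c ≠ ⊤)
    (μ : Measure α) : normalizeM (c • μ) = normalizeM μ := by
  simp only [normalizeM, Measure.smul_apply, smul_eq_mul, smul_smul]
  rw [ENNReal.mul_inv (Or.inl hc0) (Or.inl hc), mul_right_comm,
    ENNReal.inv_mul_cancel hc0 hc, one_mul]

theorem normalizeM_eq_self {α : Type*} [MeasurableSpace α] (μ : Measure α)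
    [IsProbabilityMeasure μ] : normalizeM μ = μ := by
  simp [normalizeM]

theorem isProbabilityMeasure_normalizeM {α : Type*} [MeasurableSpace α] {μ : Measure α}
    (h0 : μ Set.univ ≠ 0) (h : μ Set.univ ≠ ⊤) : IsProbabilityMeasure (normalizeM μ) :=
  ⟨by simp [normalizeM, ENNReal.inv_mul_cancel h0 h]⟩

theorem step_smul {d l : ℕ} (Q : Kernel (St d) (St d)) (Ψ : St d → St l → ℝ) (y : St l)
    (c : ℝ≥0∞) (μ : Measure (St d)) : step Q Ψ y (c • μ) = c • step Q Ψ y μ := by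
  rw [step, step, Measure.bind_smul, withDensity_smul_measure]

theorem nnFilter_smul {d l : ℕ} (Q : Kernel (St d) (St d)) (Ψ : St d → St l → ℝ)
    (ys : List (St l)) (c : ℝ≥0∞) (μ : Measure (St d)) :
    nnFilter Q Ψ ys (c • μ) = c • nnFilter Q Ψ ys μ := by
  induction ys generalizing μ with
  | nil => rfl
  | cons y ys ih =>
    change nnFilter Q Ψ ys (step Q Ψ y (c • μ)) = c • nnFilter Q Ψ ys (step Q Ψ y μ)
    rw [step_smul, ih]

/-- Normalizing after the first step does not change the normalized filter. -/
theorem nFilter_cons {d l : ℕ} (Q : Kernel (St d) (St d)) (Ψ : St d → St l → ℝ) (y : St l)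
    (ys : List (St l)) (μ : Measure (St d)) (h0 : step Q Ψ y μ Set.univ ≠ 0)
    (h : step Q Ψ y μ Set.univ ≠ ⊤) :
    nFilter Q Ψ (y :: ys) μ = nFilter Q Ψ ys (stepBar Q Ψ y μ) := by
  have hs : nnFilter Q Ψ ys (stepBar Q Ψ y μ)
      = (step Q Ψ y μ Set.univ)⁻¹ • nnFilter Q Ψ ys (step Q Ψ y μ) := nnFilter_smul ..
  rw [nFilter, nFilter, hs,
    normalizeM_smul _ (ENNReal.inv_ne_zero.2 h) (ENNReal.inv_ne_top.2 h0)]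
  rfl

theorem obsList_self {l : ℕ} (y : ℕ → St l) (n : ℕ) : obsList y n n = [] := by
  simp [obsList]

theorem obsList_of_lt {l : ℕ} (y : ℕ → St l) {k n : ℕ} (h : k < n) :
    obsList y k n = y (k + 1) :: obsList y (k + 1) n := by
  rw [obsList, obsList, show n - k = n - (k + 1) + 1 by omega, List.range_succ_eq_map,
    List.map_cons, List.map_map]
  refine congrArg _ (List.map_congr_left fun i _ => congrArg y ?_)
  simp only [Nat.succ_eq_add_one]
  omega

theorem tvDist_self {α : Type*} [MeasurableSpace α] (μ : Measure α) : tvDist μ μ = 0 := by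
  refine le_antisymm (iSup_le fun A => ?_) zero_le
  rw [add_self_eq_zero.2 (tsub_le_iff_right.2 (by simp) |>.antisymm zero_le)]

theorem tvDist_triangle {α : Type*} [MeasurableSpace α] (μ ν ρ : Measure α) :
    tvDist μ ρ ≤ tvDist μ ν + tvDist ν ρ := by
  refine iSup_le fun A => ?_
  calc (μ A - ρ A) + (ρ A - μ A)
      ≤ ((μ A - ν A) + (ν A - ρ A)) + ((ρ A - ν A) + (ν A - μ A)) :=
        add_le_add tsub_le_tsub_add_tsub tsub_le_tsub_add_tsub
    _ = ((μ A - ν A) + (ν A - μ A)) + ((ν A - ρ A) + (ρ A - ν A)) := by ring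
    _ ≤ _ := add_le_add (le_iSup (fun A => (μ A - ν A) + (ν A - μ A)) A)
        (le_iSup (fun A => (ν A - ρ A) + (ρ A - ν A)) A)

theorem tvDist_le_sum_range {α : Type*} [MeasurableSpace α] (μ : ℕ → Measure α) (n : ℕ) :
    tvDist (μ n) (μ 0) ≤ ∑ k ∈ Finset.range n, tvDist (μ (k + 1)) (μ k) := by
  induction n with
  | zero => simp [tvDist_self]
  | succ n ih =>
    rw [Finset.sum_range_succ_comm]
    exact (tvDist_triangle _ (μ n) _).trans (by gcongr)

theorem isProbabilityMeasure_wrongFilter {d l : ℕ} (P : Kernel (St d) (St d))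
    (Ξ : St d → St l → ℝ) (y : ℕ → St l) (μ₀ : Measure (St d)) [IsProbabilityMeasure μ₀] (n : ℕ)
    (h : ∀ k < n,
      0 < step P Ξ (y (k + 1)) (wrongFilter P Ξ y μ₀ k) Set.univ ∧
      step P Ξ (y (k + 1)) (wrongFilter P Ξ y μ₀ k) Set.univ ≠ ⊤) :
    IsProbabilityMeasure (wrongFilter P Ξ y μ₀ n) := by
  cases n with
  | zero => assumption
  | succ n =>
    exact isProbabilityMeasure_normalizeM (h n n.lt_succ_self).1.ne' (h n n.lt_succ_self).2

theorem filter_telescoping_decomposition {d l : ℕ}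
    (Q P : Kernel (St d) (St d)) [IsMarkovKernel Q] [IsMarkovKernel P]
    (Ψ Ξ : St d → St l → ℝ)
    (hΨm : Measurable (Function.uncurry Ψ)) (hΞm : Measurable (Function.uncurry Ξ))
    (hΨpos : ∀ (x : St d) (y : St l), 0 < Ψ x y)
    (hΞpos : ∀ (x : St d) (y : St l), 0 < Ξ x y)
    (y : ℕ → St l) (n : ℕ)
    (μ₀ : Measure (St d)) [IsProbabilityMeasure μ₀]
    (hPden : ∀ k < n,
      0 < step P Ξ (y (k + 1)) (wrongFilter P Ξ y μ₀ k) Set.univ ∧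
      step P Ξ (y (k + 1)) (wrongFilter P Ξ y μ₀ k) Set.univ ≠ ⊤)
    (hQden : ∀ k < n,
      0 < step Q Ψ (y (k + 1)) (wrongFilter P Ξ y μ₀ k) Set.univ ∧
      step Q Ψ (y (k + 1)) (wrongFilter P Ξ y μ₀ k) Set.univ ≠ ⊤)
    (hS0 : 0 < nnFilter Q Ψ (obsList y 0 n) μ₀ Set.univ ∧
      nnFilter Q Ψ (obsList y 0 n) μ₀ Set.univ ≠ ⊤)
    (hS1 : ∀ k < n,
      0 < nnFilter Q Ψ (obsList y (k + 1) n) (wrongFilter P Ξ y μ₀ (k + 1)) Set.univ ∧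
      nnFilter Q Ψ (obsList y (k + 1) n) (wrongFilter P Ξ y μ₀ (k + 1)) Set.univ ≠ ⊤)
    (hS2 : ∀ k < n,
      0 < nnFilter Q Ψ (obsList y (k + 1) n)
            (stepBar Q Ψ (y (k + 1)) (wrongFilter P Ξ y μ₀ k)) Set.univ ∧
      nnFilter Q Ψ (obsList y (k + 1) n)
            (stepBar Q Ψ (y (k + 1)) (wrongFilter P Ξ y μ₀ k)) Set.univ ≠ ⊤) :
    (∀ A : Set (St d),
      (wrongFilter P Ξ y μ₀ n A).toReal - (nFilter Q Ψ (obsList y 0 n) μ₀ A).toReal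
        = ∑ k ∈ Finset.range n,
            ((nFilter Q Ψ (obsList y (k + 1) n)
                (stepBar P Ξ (y (k + 1)) (wrongFilter P Ξ y μ₀ k)) A).toReal
              - (nFilter Q Ψ (obsList y (k + 1) n)
                  (stepBar Q Ψ (y (k + 1)) (wrongFilter P Ξ y μ₀ k)) A).toReal)) ∧
    tvDist (wrongFilter P Ξ y μ₀ n) (nFilter Q Ψ (obsList y 0 n) μ₀)
      ≤ ∑ k ∈ Finset.range n,
          tvDist
            (nFilter Q Ψ (obsList y (k + 1) n)
              (stepBar P Ξ (y (k + 1)) (wrongFilter P Ξ y μ₀ k)))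
            (nFilter Q Ψ (obsList y (k + 1) n)
              (stepBar Q Ψ (y (k + 1)) (wrongFilter P Ξ y μ₀ k))) := by
  set μ : ℕ → Measure (St d) := fun k => nFilter Q Ψ (obsList y k n) (wrongFilter P Ξ y μ₀ k)
    with hμ
  have hend : wrongFilter P Ξ y μ₀ n = μ n := by
    have := isProbabilityMeasure_wrongFilter P Ξ y μ₀ n hPden
    rw [hμ]
    simp only [obsList_self]
    exact (normalizeM_eq_self _).symm
  have hQ : ∀ k ∈ Finset.range n, nFilter Q Ψ (obsList y (k + 1) n)
      (stepBar Q Ψ (y (k + 1)) (wrongFilter P Ξ y μ₀ k)) = μ k := fun k hk => by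
    have hk := Finset.mem_range.1 hk
    rw [hμ]
    simp only [obsList_of_lt y hk]
    exact (nFilter_cons _ _ _ _ _ (hQden k hk).1.ne' (hQden k hk).2).symm
  rw [hend]
  refine ⟨fun A => ?_, ?_⟩
  · rw [Finset.sum_congr rfl fun k hk => by rw [hQ k hk]]
    exact (Finset.sum_range_sub (fun k => (μ k A).toReal) n).symm
  · rw [Finset.sum_congr rfl fun k hk => by rw [hQ k hk]]
    exact tvDist_le_sum_range μ n
end
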